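/- Let k ≥ 1 and m ≥ 0. Equip A⟨k⟩ = F₂[ξ₁, …, ξ_k] with the module structure over the polynomial ring F₂[y₁, …, y_k] given by the F₂-algebra homomorphism sending y_i to ζ̄_{m+i}. Then A⟨k⟩ is a finitely generated F₂[y₁, …, y_k]-module. -/

import Mathlib

open MvPolynomial

/-- The dual Steenrod algebra `A = F₂[ξ₁, ξ₂, …]`; the variable `X i` represents `ξ_{i+1}`. -/
noncomputable abbrev DualSteenrod : Type := MvPolynomial ℕ (ZMod 2)

/-- The conjugate classes, via Milnor's recursion
`ζ_n = ∑_{i=1}^{n} ξ_i^{2^{n−i}} ζ_{n−i}` (with `ζ_0 = 1`). -/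
noncomputable def zeta : ℕ → DualSteenrod
  | 0 => 1
  | (n+1) => ∑ i ∈ Finset.range (n+1), (X i) ^ (2^(n-i)) * zeta (n-i)
  decreasing_by omega

/-- The projection `A → A⟨k⟩ = F₂[ξ₁, …, ξ_k]`, killing `ξ_i` for `i > k`.
In `MvPolynomial (Fin k) (ZMod 2)`, the variable `X i` represents `ξ_{i+1}`. -/
noncomputable def proj (k : ℕ) :
    DualSteenrod →ₐ[ZMod 2] MvPolynomial (Fin k) (ZMod 2) :=
  aeval (fun i => if h : i < k then X (⟨i, h⟩ : Fin k) else 0)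

/-- `ζ̄_n`, the image of `ζ_n` in `A⟨k⟩`. -/
noncomputable def zetaBar (k n : ℕ) : MvPolynomial (Fin k) (ZMod 2) :=
  proj k (zeta n)

namespace MvPolynomial

variable {R σ ι : Type*} [CommRing R] [Fintype ι]

/-- A homogeneous element of an ideal generated by finitely many homogeneous polynomials is a
combination of the generators with homogeneous coefficients. -/
theorem exists_isWeightedHomogeneous_of_mem_span {w : σ → ℕ} {g : ι → MvPolynomial σ R}
    {e : ι → ℕ} (hg : ∀ j, IsWeightedHomogeneous w (g j) (e j)) {d : ℕ} {f : MvPolynomial σ R}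
    (hf : IsWeightedHomogeneous w f d) (hfg : f ∈ Ideal.span (Set.range g)) :
    ∃ a : ι → MvPolynomial σ R,
      (∀ j, a j = 0 ∨ e j ≤ d ∧ IsWeightedHomogeneous w (a j) (d - e j)) ∧
        ∑ j, a j * g j = f := by
  classical
  let := weightedGradedAlgebra R w
  obtain ⟨c, hc⟩ := Ideal.mem_span_range_iff_exists_fun.1 hfg
  refine ⟨fun j => if e j ≤ d then
    (DirectSum.decompose (weightedHomogeneousSubmodule R w) (c j) (d - e j) :
      MvPolynomial σ R) else 0, fun j => ?_, ?_⟩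
  · by_cases h : e j ≤ d
    · right
      simp only [h, if_true, true_and]
      exact (DirectSum.decompose (weightedHomogeneousSubmodule R w) (c j) (d - e j)).2
    · left
      simp [h]
  · have key := DirectSum.decompose_of_mem_same (weightedHomogeneousSubmodule R w) hf
    rw [← hc, DirectSum.decompose_sum, DFinsupp.finsetSum_apply, Submodule.coe_sum] at key
    rw [← hc, ← key]
    refine Finset.sum_congr rfl fun j _ => ?_
    rw [DirectSum.coe_decompose_mul_of_right_mem (weightedHomogeneousSubmodule R w) d (hg j)]
    by_cases h : e j ≤ d <;> simp only [h, if_true, if_false, zero_mul]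

/-- If homogeneous polynomials of positive degrees generate an ideal whose radical contains all
the variables, then the polynomial ring is finite over the subalgebra they generate. -/
theorem finite_aeval_of_X_mem_radical [Finite σ] {w : σ → ℕ} {g : ι → MvPolynomial σ R}
    {e : ι → ℕ} (hg : ∀ j, IsWeightedHomogeneous w (g j) (e j)) (he : ∀ j, 0 < e j)
    (hX : ∀ i, X i ∈ (Ideal.span (Set.range g)).radical) :
    (aeval g : MvPolynomial ι R →ₐ[R] MvPolynomial σ R).toRingHom.Finite := by
  classical
  choose N hN using hX
  let : Algebra (MvPolynomial ι R) (MvPolynomial σ R) :=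
    (aeval g : MvPolynomial ι R →ₐ[R] MvPolynomial σ R).toRingHom.toAlgebra
  have smul_eq (b : MvPolynomial ι R) (x : MvPolynomial σ R) : b • x = aeval g b * x := rfl
  let S : Set (σ →₀ ℕ) := {s | ∀ i, s i < N i}
  have hS : S.Finite := (Set.finite_Icc 0 (Finsupp.equivFunOnFinite.symm N)).subset
    fun s hs => ⟨zero_le, fun i => (hs i).le⟩
  let M := Submodule.span (MvPolynomial ι R) ((fun s => monomial s (1 : R)) '' S)
  have hM (d : ℕ) : ∀ f, IsWeightedHomogeneous w f d → f ∈ M := by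
    induction d using Nat.strong_induction_on with
    | _ d ih =>
      intro f hf
      rw [f.as_sum]
      refine sum_mem fun s hs => ?_
      by_cases hsS : s ∈ S
      · have : monomial s (coeff s f) =
            (C (coeff s f) : MvPolynomial ι R) • monomial s (1 : R) := by
          rw [smul_eq, aeval_C, algebraMap_eq, C_mul_monomial, mul_one]
        rw [this]
        exact M.smul_mem _ (Submodule.subset_span ⟨s, hsS, rfl⟩)
      · obtain ⟨i, hi⟩ : ∃ i, N i ≤ s i := by simpa [S] using hsS
        have hsI : monomial s (coeff s f) ∈ Ideal.span (Set.range g) := by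
          have hle : Finsupp.single i (N i) ≤ s := by simpa using hi
          rw [← tsub_add_cancel_of_le hle, ← mul_one (coeff _ f), ← monomial_mul,
            ← X_pow_eq_monomial]
          exact Ideal.mul_mem_left _ _ (hN i)
        obtain ⟨a, ha, hsum⟩ := exists_isWeightedHomogeneous_of_mem_span hg
          (isWeightedHomogeneous_monomial w s (coeff s f) (hf (mem_support_iff.1 hs))) hsI
        rw [← hsum]
        refine sum_mem fun j _ => ?_
        have hj : a j * g j = (X j : MvPolynomial ι R) • a j := by
          rw [smul_eq, aeval_X, mul_comm]
        rw [hj]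
        refine M.smul_mem _ ?_
        obtain h | ⟨hle, h⟩ := ha j
        · rw [h]
          exact M.zero_mem
        · exact ih _ (Nat.sub_lt ((he j).trans_le hle) (he j)) _ h
  have hM_top : M = ⊤ := by
    refine eq_top_iff.2 fun f _ => ?_
    rw [f.as_sum]
    exact sum_mem fun s _ => hM _ _ (isWeightedHomogeneous_monomial w s _ rfl)
  exact Module.finite_def.2 (Submodule.fg_def.2 ⟨_, hS.image _, hM_top⟩)

end MvPolynomial

theorem Nat.exists_greatest_of_eventually_not {p : ℕ → Prop} {b : ℕ} (hp : ∃ n, p n)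
    (hb : ∀ n, b ≤ n → ¬ p n) : ∃ n, p n ∧ ∀ l, n < l → ¬ p l := by
  classical
  obtain ⟨n, hn⟩ := hp
  have hnb : n ≤ b := le_of_not_ge fun h => hb n h hn
  refine ⟨Nat.findGreatest p b, Nat.findGreatest_spec hnb hn, fun l hl => ?_⟩
  obtain h | h := le_total l b
  · exact Nat.findGreatest_is_greatest hl h
  · exact hb l h

/-- The image of `ξ_{i+1}` in `A⟨k⟩`. -/
noncomputable def xiBar (k i : ℕ) : MvPolynomial (Fin k) (ZMod 2) :=
  proj k (X i)

theorem xiBar_of_lt {k i : ℕ} (h : i < k) : xiBar k i = X ⟨i, h⟩ := by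
  simp [xiBar, proj, h]

theorem xiBar_of_le {k i : ℕ} (h : k ≤ i) : xiBar k i = 0 := by
  simp [xiBar, proj, h.not_gt]

theorem zetaBar_zero (k : ℕ) : zetaBar k 0 = 1 := by
  simp [zetaBar, zeta]

theorem zetaBar_succ (k n : ℕ) :
    zetaBar k (n + 1) =
      ∑ i ∈ Finset.range (n + 1), xiBar k i ^ 2 ^ (n - i) * zetaBar k (n - i) := by
  simp [zetaBar, xiBar, zeta]

theorem isWeightedHomogeneous_xiBar (k i : ℕ) :
    IsWeightedHomogeneous (fun j : Fin k => 2 ^ ((j : ℕ) + 1) - 1) (xiBar k i)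
      (2 ^ (i + 1) - 1) := by
  obtain h | h := lt_or_ge i k
  · rw [xiBar_of_lt h]
    exact isWeightedHomogeneous_X _ _ _
  · rw [xiBar_of_le h]
    exact isWeightedHomogeneous_zero _ _ _

theorem isWeightedHomogeneous_zetaBar (k n : ℕ) :
    IsWeightedHomogeneous (fun j : Fin k => 2 ^ ((j : ℕ) + 1) - 1) (zetaBar k n)
      (2 ^ n - 1) := by
  induction n using Nat.strong_induction_on with
  | _ n ih =>
    cases n with
    | zero =>
      rw [zetaBar_zero]
      exact isWeightedHomogeneous_one _ _
    | succ n =>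
      rw [zetaBar_succ]
      refine IsWeightedHomogeneous.sum _ _ _ fun i hi => ?_
      have hi : i ≤ n := Nat.lt_succ_iff.1 (Finset.mem_range.1 hi)
      convert ((isWeightedHomogeneous_xiBar k i).pow (2 ^ (n - i))).mul
        (ih (n - i) (by omega)) using 1
      have hpow : 2 ^ (n - i) * 2 ^ (i + 1) = 2 ^ (n + 1) := by
        rw [← pow_add]
        congr 1
        omega
      have hle : 2 ^ (n - i) ≤ 2 ^ (n + 1) := Nat.pow_le_pow_right two_pos (by omega)
      have hpos : 0 < 2 ^ (n - i) := by positivity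
      rw [smul_eq_mul, Nat.mul_sub, hpow, mul_one]
      omega

section Prime

variable {k m : ℕ} {P : Ideal (MvPolynomial (Fin k) (ZMod 2))}

/-- An ideal containing `k` consecutive `ζ̄_n` contains all later ones. -/
theorem zetaBar_mem_of_consecutive (hP : ∀ i < k, zetaBar k (m + 1 + i) ∈ P) (n : ℕ) :
    zetaBar k (m + 1 + n) ∈ P := by
  induction n using Nat.strong_induction_on with
  | _ n ih =>
    obtain h | h := lt_or_ge n k
    · exact hP n h
    · rw [show m + 1 + n = m + n + 1 by omega, zetaBar_succ]
      refine sum_mem fun i _ => ?_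
      obtain hi | hi := lt_or_ge i k
      · rw [show m + n - i = m + 1 + (n - 1 - i) by omega]
        exact P.mul_mem_left _ (ih _ (by omega))
      · rw [xiBar_of_le hi, zero_pow (by positivity), zero_mul]
        exact P.zero_mem

/-- A prime ideal containing `k` consecutive `ζ̄_n` contains every `ξ_i`. -/
theorem xiBar_mem_of_consecutive [hprime : P.IsPrime]
    (hP : ∀ i < k, zetaBar k (m + 1 + i) ∈ P) (i : ℕ) : xiBar k i ∈ P := by
  by_contra hi
  obtain ⟨r, hr, hr_max⟩ := Nat.exists_greatest_of_eventually_not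
    (p := fun i => xiBar k i ∉ P) (b := k) ⟨i, hi⟩
    fun n hn => by simp [xiBar_of_le hn]
  obtain ⟨s, hs, hs_max⟩ := Nat.exists_greatest_of_eventually_not
    (p := fun n => zetaBar k n ∉ P) (b := m + 1)
    ⟨0, by simpa [zetaBar_zero] using P.one_notMem⟩ fun n hn => by
      obtain ⟨l, rfl⟩ := Nat.exists_eq_add_of_le hn
      exact not_not.2 (zetaBar_mem_of_consecutive hP l)
  have hmem : zetaBar k (r + s + 1) ∈ P := not_not.1 (hs_max _ (by omega))
  rw [zetaBar_succ, ← Finset.add_sum_erase _ _ (Finset.mem_range.2 (by omega : r < r + s + 1)),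
    P.add_mem_iff_left, Nat.add_sub_cancel_left] at hmem
  · exact (hprime.mem_or_mem hmem).elim (fun h => hr (hprime.mem_of_pow_mem _ h)) hs
  · refine sum_mem fun j hj => ?_
    obtain h | h := lt_or_gt_of_ne (Finset.ne_of_mem_erase hj)
    · exact P.mul_mem_left _ (not_not.1 (hs_max _ (by omega)))
    · exact P.mul_mem_right _
        (P.pow_mem_of_mem (not_not.1 (hr_max j h)) _ (by positivity))

end Prime

/-- For `k ≥ 1` and `m ≥ 0`, the ring map
`F₂[y₁, …, y_k] → A⟨k⟩` sending `y_i ↦ ζ̄_{m+i}` is finite, i.e. `A⟨k⟩` is a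
finitely generated module over `F₂[y₁, …, y_k]` via this map. -/
theorem finite_over_zetaBar_polynomials (k m : ℕ) (hk : 1 ≤ k) :
    ((MvPolynomial.aeval fun i : Fin k => zetaBar k (m + 1 + (i : ℕ)) :
        MvPolynomial (Fin k) (ZMod 2) →ₐ[ZMod 2]
          MvPolynomial (Fin k) (ZMod 2)).toRingHom).Finite := by
  refine finite_aeval_of_X_mem_radical (fun j => isWeightedHomogeneous_zetaBar k _)
    (fun j => Nat.sub_pos_of_lt (Nat.one_lt_two_pow (by omega))) fun i => ?_
  rw [Ideal.radical_eq_sInf, Ideal.mem_sInf]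
  rintro P ⟨hle, hprime⟩
  rw [← xiBar_of_lt i.2]
  exact xiBar_mem_of_consecutive (m := m)
    (fun j hj => hle (Ideal.subset_span ⟨⟨j, hj⟩, rfl⟩)) i
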